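/- Let l ∈ ℤ≥0, R = ℂ[t]/(t^{l+1}), q ≥ 1, let n_1,…,n_q be positive integers with N = n_1+…+n_q, let m ≥ 2N, and let 0 ≤ λ̄_1 < … < λ̄_q ≤ l be integers. Let δ' be the 2N×2N block diagonal matrix with blocks t^{λ̄_1}S_{n_1}, …, t^{λ̄_q}S_{n_q}, and let δ be the m×m block diagonal matrix with blocks δ' and the (m−2N)×(m−2N) zero matrix. Write A ∈ M_m(R) in blocks A = [[A_1, A_2],[A_3, A_4]] with A_1 of size 2N×2N, and write A_3 = (A_{31},…,A_{3q}) with A_{3i} of size (m−2N)×2n_i. Then A is invertible over R with A δ Aᵀ = δ if and only if the following hold: A_1 δ' A_1ᵀ = δ', every entry of A_{3i} is divisible by t^{l+1−λ̄_i} for each i = 1,…,q, and A_4 is invertible over R (the block A_2 being arbitrary). -/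

import Mathlib

open Matrix

noncomputable section

/-- The jet ring `R_l = ℂ[t]/(t^{l+1})`. -/
abbrev Rl (l : ℕ) : Type :=
  Polynomial ℂ ⧸ Ideal.span ({Polynomial.X ^ (l + 1)} : Set (Polynomial ℂ))

/-- The image of `t` in `R_l = ℂ[t]/(t^{l+1})`. -/
def tq (l : ℕ) : Rl l := Ideal.Quotient.mk _ Polynomial.X

/-- `S_k`, the `2k × 2k` block diagonal matrix with `k` copies of `J = [[0,1],[-1,0]]`. -/
def Smat (R : Type*) [CommRing R] (k : ℕ) : Matrix (Fin (2 * k)) (Fin (2 * k)) R :=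
  Matrix.of fun i j =>
    if (i : ℕ) / 2 = (j : ℕ) / 2 then
      (if (i : ℕ) % 2 = 0 ∧ (j : ℕ) % 2 = 1 then 1
       else if (i : ℕ) % 2 = 1 ∧ (j : ℕ) % 2 = 0 then -1 else 0)
    else 0

/-- Evaluation at `t = 0`, as a ring homomorphism `R_l → ℂ`. -/
def evalZero (l : ℕ) : Rl l →+* ℂ :=
  Ideal.Quotient.lift _ (Polynomial.evalRingHom (0 : ℂ)) (by
    intro p hp
    obtain ⟨c, rfl⟩ := Ideal.mem_span_singleton.mp hp
    simp)

lemma evalZero_mk (l : ℕ) (p : Polynomial ℂ) :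
    evalZero l (Ideal.Quotient.mk _ p) = p.eval 0 := rfl

lemma evalZero_tq (l : ℕ) : evalZero l (tq l) = 0 := by
  simp [tq, evalZero_mk]

lemma tq_pow_eq_zero (l : ℕ) : tq l ^ (l + 1) = 0 := by
  rw [tq, ← map_pow, Ideal.Quotient.eq_zero_iff_mem]
  exact Ideal.mem_span_singleton_self _

instance evalZero_isLocalHom (l : ℕ) : IsLocalHom (evalZero l) where
  map_nonunit x hx := by
    obtain ⟨p, rfl⟩ := Ideal.Quotient.mk_surjective x
    rw [evalZero_mk] at hx
    rw [← Polynomial.divX_mul_X_add p, map_add, map_mul]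
    refine IsNilpotent.isUnit_add_right_of_commute ?_ ?_ (Commute.all _ _)
    · exact (Commute.all _ _).isNilpotent_mul_left ⟨l + 1, tq_pow_eq_zero l⟩
    · refine IsUnit.map _ (Polynomial.isUnit_C.mpr ?_)
      rwa [Polynomial.coeff_zero_eq_eval_zero]

lemma isUnit_matrix_iff_evalZero {n : Type*} [Fintype n] [DecidableEq n] (l : ℕ)
    (M : Matrix n n (Rl l)) : IsUnit M ↔ IsUnit (M.map (evalZero l)).det := by
  rw [Matrix.isUnit_iff_isUnit_det, ← RingHom.mapMatrix_apply, ← RingHom.map_det,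
    isUnit_map_iff]

lemma isUnit_iff_of_evalZero_toBlocks₂₁ {n k : Type*} [Fintype n] [DecidableEq n] [Fintype k]
    [DecidableEq k] (l : ℕ) (A : Matrix (n ⊕ k) (n ⊕ k) (Rl l))
    (h : A.toBlocks₂₁.map (evalZero l) = 0) :
    IsUnit A ↔ IsUnit A.toBlocks₁₁ ∧ IsUnit A.toBlocks₂₂ := by
  simp only [isUnit_matrix_iff_evalZero]
  conv_lhs => rw [← Matrix.fromBlocks_toBlocks A, Matrix.fromBlocks_map, h,
    Matrix.det_fromBlocks_zero₂₁, IsUnit.mul_iff]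

lemma tq_pow_dvd_iff {l d : ℕ} (hd : d ≤ l) (x : Rl l) :
    tq l ^ (l + 1 - d) ∣ x ↔ tq l ^ d * x = 0 := by
  constructor
  · rintro ⟨y, rfl⟩
    rw [← mul_assoc, ← pow_add, show d + (l + 1 - d) = l + 1 by omega, tq_pow_eq_zero, zero_mul]
  · obtain ⟨p, rfl⟩ := Ideal.Quotient.mk_surjective x
    intro h
    rw [tq, ← map_pow, ← map_mul, Ideal.Quotient.eq_zero_iff_mem, Ideal.mem_span_singleton,
      show l + 1 = d + (l + 1 - d) by omega, pow_add] at h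
    rw [tq, ← map_pow]
    exact map_dvd _ ((mul_dvd_mul_iff_left (pow_ne_zero _ Polynomial.X_ne_zero)).mp h)

lemma evalZero_eq_zero_of_dvd {l d : ℕ} (hd : d ≤ l) {x : Rl l}
    (h : tq l ^ (l + 1 - d) ∣ x) : evalZero l x = 0 := by
  obtain ⟨y, rfl⟩ := h
  rw [map_mul, map_pow, evalZero_tq, zero_pow (by omega), zero_mul]

lemma Smat_mul_transpose (R : Type*) [CommRing R] (k : ℕ) : Smat R k * (Smat R k)ᵀ = 1 := by
  have key (i : Fin (2 * k)) : ∃ p : Fin (2 * k), (p : ℕ) / 2 = i / 2 ∧ (p : ℕ) % 2 ≠ i % 2 := by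
    by_cases hi : (i : ℕ) % 2 = 0
    · exact ⟨⟨i + 1, by omega⟩, by simp; omega, by simp; omega⟩
    · exact ⟨⟨i - 1, by omega⟩, by simp; omega, by simp; omega⟩
  ext i j
  obtain ⟨p, hp, hp'⟩ := key i
  rw [Matrix.mul_apply, Finset.sum_eq_single p]
  · rcases eq_or_ne i j with rfl | hij
    · rw [Matrix.one_apply_eq]
      simp only [Smat, Matrix.transpose_apply, Matrix.of_apply, hp]
      rcases Nat.mod_two_eq_zero_or_one i with h | h <;>
        rcases Nat.mod_two_eq_zero_or_one p with h' | h' <;> simp_all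
    · rw [Matrix.one_apply_ne hij]
      have : Smat R k j p = 0 := by
        have hne : (i : ℕ) ≠ j := fun h => hij (Fin.ext h)
        simp only [Smat, Matrix.of_apply]
        split_ifs <;> first | rfl | (exfalso; omega)
      rw [Matrix.transpose_apply, this, mul_zero]
  · intro x _ hx
    have : Smat R k i x = 0 := by
      have hne : (x : ℕ) ≠ p := fun h => hx (Fin.ext h)
      simp only [Smat, Matrix.of_apply]
      split_ifs <;> first | rfl | (exfalso; omega)
    rw [this, zero_mul]
  · simp

lemma Smat_map {R R' : Type*} [CommRing R] [CommRing R'] (f : R →+* R') (k : ℕ) :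
    (Smat R k).map f = Smat R' k := by
  ext i j
  simp only [Smat, Matrix.map_apply, Matrix.of_apply]
  split_ifs <;> simp

lemma Smat_transpose (R : Type*) [CommRing R] (k : ℕ) : (Smat R k)ᵀ = -Smat R k := by
  ext i j
  simp only [Smat, Matrix.transpose_apply, Matrix.neg_apply, Matrix.of_apply]
  split_ifs <;> first | (exfalso; omega) | simp

section Blocks

variable {ι : Type*} [DecidableEq ι] (nn d : ι → ℕ)

/-- The block diagonal matrix with blocks `x^{d_i} S_{n_i}`. -/
abbrev blockS {R : Type*} [CommRing R] (x : R) :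
    Matrix ((i : ι) × Fin (2 * nn i)) ((i : ι) × Fin (2 * nn i)) R :=
  Matrix.blockDiagonal' (fun i => x ^ d i • Smat R (nn i))

lemma blockS_map {R R' : Type*} [CommRing R] [CommRing R'] (f : R →+* R') (x : R) :
    (blockS nn d x).map f = blockS nn d (f x) := by
  rw [blockS, Matrix.blockDiagonal'_map _ _ (map_zero f)]
  congr 1
  ext i : 1
  rw [← Smat_map f]
  ext a b
  simp

variable [Fintype ι]

lemma blockS_mul_blockDiagonal' {R : Type*} [CommRing R] (x : R) (e : ι → ℕ) :
    blockS nn d x * Matrix.blockDiagonal' (fun i => x ^ e i • (Smat R (nn i))ᵀ) =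
      Matrix.blockDiagonal' (fun i => x ^ (d i + e i) • 1) := by
  rw [← Matrix.blockDiagonal'_mul]
  simp [Smat_mul_transpose, smul_smul, pow_add, mul_comm]

variable {nn d}

lemma mul_blockDiagonal'_smul_one_apply {R k : Type*} [CommRing R]
    (B : Matrix k ((i : ι) × Fin (2 * nn i)) R) (c : ι → R) (a : k) (i : ι) (b : Fin (2 * nn i)) :
    (B * Matrix.blockDiagonal' (fun i => c i • (1 : Matrix (Fin (2 * nn i)) (Fin (2 * nn i)) R)))
        a ⟨i, b⟩ =
      c i * B a ⟨i, b⟩ := by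
  have : Matrix.blockDiagonal' (fun i => c i • (1 : Matrix (Fin (2 * nn i)) (Fin (2 * nn i)) R)) =
      Matrix.diagonal (fun p : (i : ι) × Fin (2 * nn i) => c p.1) := by
    simp only [Matrix.smul_one_eq_diagonal, Matrix.blockDiagonal'_diagonal]
  rw [this, Matrix.mul_diagonal, mul_comm]

lemma mul_blockS_eq_zero_iff {R k : Type*} [CommRing R] (x : R)
    (B : Matrix k ((i : ι) × Fin (2 * nn i)) R) :
    B * blockS nn d x = 0 ↔ ∀ i a b, x ^ d i * B a ⟨i, b⟩ = 0 := by
  have hfac : blockS nn d x =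
      Matrix.blockDiagonal' (fun i => x ^ d i • 1) * blockS nn 0 x := by
    rw [blockS, blockS, ← Matrix.blockDiagonal'_mul]
    simp
  constructor
  · intro h i a b
    have h' := congrArg (· * Matrix.blockDiagonal' (fun i => x ^ 0 • (Smat R (nn i))ᵀ)) h
    simp only [Matrix.mul_assoc, Matrix.zero_mul] at h'
    rw [blockS_mul_blockDiagonal' nn d x (fun _ => 0)] at h'
    have := congrFun (congrFun h' a) ⟨i, b⟩
    rwa [mul_blockDiagonal'_smul_one_apply] at this
  · intro h
    rw [hfac, ← Matrix.mul_assoc]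
    convert Matrix.zero_mul _
    ext a ⟨i, b⟩
    rw [mul_blockDiagonal'_smul_one_apply, h]
    rfl

lemma isUnit_of_mul_blockS_mul_transpose {l : ℕ} (hd : ∀ i, d i ≤ l)
    (M : Matrix ((i : ι) × Fin (2 * nn i)) ((i : ι) × Fin (2 * nn i)) (Rl l))
    (h : M * blockS nn d (tq l) * Mᵀ = blockS nn d (tq l)) : IsUnit M := by
  let π : Polynomial ℂ →+* Rl l := Ideal.Quotient.mk _
  obtain ⟨P, rfl⟩ : ∃ P : Matrix _ _ (Polynomial ℂ), P.map π = M :=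
    ⟨M.map (Function.surjInv Ideal.Quotient.mk_surjective), by
      ext a b
      exact Function.surjInv_eq Ideal.Quotient.mk_surjective (M a b)⟩
  set D := blockS nn d (Polynomial.X : Polynomial ℂ) with hD
  have hDD : D * Matrix.blockDiagonal' (fun i => (Polynomial.X : Polynomial ℂ) ^ (l - d i) •
      (Smat (Polynomial ℂ) (nn i))ᵀ) = (Polynomial.X : Polynomial ℂ) ^ l • 1 := by
    rw [hD, blockS_mul_blockDiagonal']
    simp only [Nat.add_sub_cancel' (hd _)]
    rw [← Matrix.blockDiagonal'_one, ← Matrix.blockDiagonal'_smul]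
    rfl
  set D' := Matrix.blockDiagonal' (fun i => (Polynomial.X : Polynomial ℂ) ^ (l - d i) •
      (Smat (Polynomial ℂ) (nn i))ᵀ)
  have hdet : D.det ≠ 0 := by
    intro h0
    have := congrArg Matrix.det hDD
    rw [Matrix.det_mul, h0, zero_mul, Matrix.det_smul, Matrix.det_one, mul_one] at this
    exact pow_ne_zero _ (pow_ne_zero _ Polynomial.X_ne_zero) this.symm
  have hE : ∃ E, P * D * Pᵀ = D + (Polynomial.X : Polynomial ℂ) ^ (l + 1) • E := by
    have hdvd (a b) : (Polynomial.X : Polynomial ℂ) ^ (l + 1) ∣ (P * D * Pᵀ) a b - D a b := by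
      rw [← Ideal.mem_span_singleton, ← Ideal.Quotient.eq_zero_iff_mem, map_sub, sub_eq_zero]
      have hmap : (P * D * Pᵀ).map π = D.map π := by
        rw [Matrix.map_mul, Matrix.map_mul, Matrix.transpose_map, hD, blockS_map]
        exact h
      exact congrFun (congrFun hmap a) b
    choose E hE using hdvd
    refine ⟨Matrix.of E, ?_⟩
    ext1 a b
    simp [← hE]
  obtain ⟨E, hE⟩ := hE
  have hfac : P * D * Pᵀ = D * (1 + (Polynomial.X : Polynomial ℂ) • (D' * E)) := by
    rw [hE, Matrix.mul_add, Matrix.mul_one, Matrix.mul_smul, ← Matrix.mul_assoc, hDD,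
      Matrix.smul_mul, Matrix.one_mul, smul_smul, pow_succ']
  have hsq : P.det * P.det = (1 + (Polynomial.X : Polynomial ℂ) • (D' * E)).det := by
    have := congrArg Matrix.det hfac
    rw [Matrix.det_mul, Matrix.det_mul, Matrix.det_mul, Matrix.det_transpose] at this
    exact mul_left_cancel₀ hdet (by rw [← this]; ring)
  have hone : Polynomial.evalRingHom (0 : ℂ) P.det * Polynomial.evalRingHom (0 : ℂ) P.det = 1 := by
    rw [← map_mul, hsq, RingHom.map_det, map_add, map_one]
    have hzero : (Polynomial.evalRingHom (0 : ℂ)).mapMatrix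
        ((Polynomial.X : Polynomial ℂ) • (D' * E)) = 0 := by
      ext a b
      simp
    rw [hzero, add_zero, Matrix.det_one]
  have hunit : IsUnit (Polynomial.evalRingHom (0 : ℂ) P.det) := .of_mul_eq_one _ hone
  rw [isUnit_matrix_iff_evalZero]
  rw [RingHom.map_det] at hunit
  exact hunit

end Blocks

/-- Description of the stabilizer of `δ = diag(δ', 0)` (with `δ'` block diagonal with
blocks `t^{λ̄_1}S_{n_1}, …, t^{λ̄_q}S_{n_q}`) under congruence by `GL_m(R_l)`:
`A` is invertible with `A δ Aᵀ = δ` iff `A_1 δ' A_1ᵀ = δ'`, every entry of the block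
`A_{3i}` is divisible by `t^{l+1−λ̄_i}`, and `A_4` is invertible (`A_2` arbitrary). -/
theorem stabilizer_description (l q m : ℕ) (hq : 1 ≤ q)
    (nn : Fin q → ℕ) (hnn : ∀ i, 1 ≤ nn i)
    (N : ℕ) (hN : N = ∑ i, nn i) (hm : 2 * N ≤ m)
    (lamb : Fin q → ℕ) (hmono : StrictMono lamb) (hle : ∀ i, lamb i ≤ l)
    (A : Matrix (((i : Fin q) × Fin (2 * nn i)) ⊕ Fin (m - 2 * N))
      (((i : Fin q) × Fin (2 * nn i)) ⊕ Fin (m - 2 * N)) (Rl l)) :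
    (IsUnit A ∧
        A * Matrix.fromBlocks
            (Matrix.blockDiagonal' (fun i => tq l ^ lamb i • Smat (Rl l) (nn i))) 0 0 0 * Aᵀ =
          Matrix.fromBlocks
            (Matrix.blockDiagonal' (fun i => tq l ^ lamb i • Smat (Rl l) (nn i))) 0 0 0) ↔
      (A.toBlocks₁₁ * Matrix.blockDiagonal' (fun i => tq l ^ lamb i • Smat (Rl l) (nn i)) *
          A.toBlocks₁₁ᵀ =
        Matrix.blockDiagonal' (fun i => tq l ^ lamb i • Smat (Rl l) (nn i)) ∧
      (∀ (i : Fin q) (a : Fin (m - 2 * N)) (b : Fin (2 * nn i)),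
        tq l ^ (l + 1 - lamb i) ∣ A.toBlocks₂₁ a ⟨i, b⟩) ∧
      IsUnit A.toBlocks₂₂) := by
  have hdvd : (∀ (i : Fin q) (a : Fin (m - 2 * N)) (b : Fin (2 * nn i)),
      tq l ^ (l + 1 - lamb i) ∣ A.toBlocks₂₁ a ⟨i, b⟩) ↔
      A.toBlocks₂₁ * blockS nn lamb (tq l) = 0 := by
    simp only [mul_blockS_eq_zero_iff, tq_pow_dvd_iff (hle _)]
  have hunit (h : A.toBlocks₂₁ * blockS nn lamb (tq l) = 0) :
      IsUnit A ↔ IsUnit A.toBlocks₁₁ ∧ IsUnit A.toBlocks₂₂ := by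
    refine isUnit_iff_of_evalZero_toBlocks₂₁ l A ?_
    ext a ⟨i, b⟩
    exact evalZero_eq_zero_of_dvd (hle i) (hdvd.mpr h i a b)
  rw [hdvd]
  have hmul : A * Matrix.fromBlocks (blockS nn lamb (tq l)) 0 0 0 =
      Matrix.fromBlocks (A.toBlocks₁₁ * blockS nn lamb (tq l)) 0
        (A.toBlocks₂₁ * blockS nn lamb (tq l)) 0 := by
    conv_lhs => rw [← Matrix.fromBlocks_toBlocks A]
    simp [Matrix.fromBlocks_multiply]
  have htr : Aᵀ = Matrix.fromBlocks A.toBlocks₁₁ᵀ A.toBlocks₂₁ᵀ A.toBlocks₁₂ᵀ A.toBlocks₂₂ᵀ := by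
    conv_lhs => rw [← Matrix.fromBlocks_toBlocks A, Matrix.fromBlocks_transpose]
  rw [hmul]
  constructor
  · rintro ⟨hA, h⟩
    have h21 : A.toBlocks₂₁ * blockS nn lamb (tq l) = 0 := by
      obtain ⟨C, hC⟩ := ((Matrix.isUnit_transpose A).mpr hA).exists_right_inv
      have h' := congrArg (· * C) h
      simp only [Matrix.mul_assoc, hC, Matrix.mul_one] at h'
      rw [← Matrix.fromBlocks_toBlocks C, Matrix.fromBlocks_multiply, Matrix.fromBlocks_inj] at h'
      simpa using h'.2.2.1
    refine ⟨?_, h21, ((hunit h21).mp hA).2⟩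
    rw [htr, Matrix.fromBlocks_multiply, Matrix.fromBlocks_inj] at h
    simpa using h.1
  · rintro ⟨h11, h21, h22⟩
    refine ⟨(hunit h21).mpr ⟨isUnit_of_mul_blockS_mul_transpose hle _ h11, h22⟩, ?_⟩
    have h12 : A.toBlocks₁₁ * blockS nn lamb (tq l) * A.toBlocks₂₁ᵀ = 0 := by
      have hskew : (blockS nn lamb (tq l))ᵀ = -blockS nn lamb (tq l) := by
        rw [Matrix.blockDiagonal'_transpose, ← Matrix.blockDiagonal'_neg]
        congr 1
        ext i : 1
        simp [Smat_transpose]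
      have := congrArg Matrix.transpose h21
      rw [Matrix.transpose_mul, hskew, Matrix.transpose_zero, Matrix.neg_mul, neg_eq_zero] at this
      rw [Matrix.mul_assoc, this, Matrix.mul_zero]
    rw [htr, Matrix.fromBlocks_multiply, h21, h12, h11]
    simp

end
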